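/- Let n ∈ ℕ, r₁,…,rₙ > 0, let K be a singular kernel function satisfying the monotonicity condition (M), and let J be an upper semicontinuous n-field function. Let x, y ∈ Y satisfy m̲(x) = m(S) = M(S) = m̄(y) (i.e., x is a maximin point and y is a minimax point). Then there exists j ∈ {0,1,…,n} such that m_j(x) = m(S) = M(S) = m_j(y). -/

import Mathlib

open Set Filter

noncomputable section

/-- A kernel function: `ℝ ∪ {−∞}`-valued (modeled as `EReal`, never `⊤`),
finite and concave on `(-1,0)` and `(0,1)`, extended continuously to `[-1,1]`. -/
structure IsKernel (K : ℝ → EReal) : Prop where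
  ne_top : ∀ t, K t ≠ ⊤
  finite_off_zero : ∀ t ∈ Ioo (-1:ℝ) 1, t ≠ 0 → K t ≠ ⊥
  concave_neg : ConcaveOn ℝ (Ioo (-1:ℝ) 0) (fun t => (K t).toReal)
  concave_pos : ConcaveOn ℝ (Ioo (0:ℝ) 1) (fun t => (K t).toReal)
  lim_zero_left : Tendsto K (nhdsWithin 0 (Iio 0)) (nhds (K 0))
  lim_zero_right : Tendsto K (nhdsWithin 0 (Ioi 0)) (nhds (K 0))
  lim_neg_one : Tendsto K (nhdsWithin (-1) (Ioi (-1))) (nhds (K (-1)))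
  lim_one : Tendsto K (nhdsWithin 1 (Iio 1)) (nhds (K 1))

/-- Singularity condition `(∞)`: `K(0) = −∞`. -/
def SingularKernel (K : ℝ → EReal) : Prop := K 0 = ⊥

/-- Monotonicity condition (M). -/
def MonotoneKernel (K : ℝ → EReal) : Prop :=
  AntitoneOn K (Ioo (-1:ℝ) 0) ∧ MonotoneOn K (Ioo (0:ℝ) 1)

/-- Strict monotonicity condition (SM). -/
def StrictMonotoneKernel (K : ℝ → EReal) : Prop :=
  StrictAntiOn K (Ico (-1:ℝ) 0) ∧ StrictMonoOn K (Ioc (0:ℝ) 1)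

/-- Strict concavity of a kernel function. -/
def StrictConcaveKernel (K : ℝ → EReal) : Prop :=
  StrictConcaveOn ℝ (Ioo (-1:ℝ) 0) (fun t => (K t).toReal) ∧
  StrictConcaveOn ℝ (Ioo (0:ℝ) 1) (fun t => (K t).toReal)

/-- An `n`-field function: bounded above, never `+∞`, finite on a set of weighted
cardinality exceeding `n` (interior points of `[0,1]` count `1`, the endpoints `1/2`). -/
def IsFieldFn (n : ℕ) (J : ℝ → EReal) : Prop :=
  (∀ t, J t ≠ ⊤) ∧ (∃ M : ℝ, ∀ t ∈ Icc (0:ℝ) 1, J t ≤ (M : EReal)) ∧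
  ∃ T : Finset ℝ, (T : Set ℝ) ⊆ Icc (0:ℝ) 1 ∧ (∀ t ∈ T, J t ≠ ⊥) ∧
    (n : ℝ) < ∑ t ∈ T, (if t = 0 ∨ t = 1 then (1/2 : ℝ) else 1)

/-- The closed simplex `S̄`. -/
def closedSimplex (n : ℕ) : Set (Fin n → ℝ) :=
  {y | Monotone y ∧ ∀ j, y j ∈ Icc (0:ℝ) 1}

/-- The open simplex `S`. -/
def openSimplex (n : ℕ) : Set (Fin n → ℝ) :=
  {y | StrictMono y ∧ ∀ j, y j ∈ Ioo (0:ℝ) 1}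

/-- Extended nodes: `y₀ = 0`, `y_{n+1} = 1`. -/
def extNode {n : ℕ} (y : Fin n → ℝ) (j : Fin (n + 2)) : ℝ :=
  if _h0 : (j : ℕ) = 0 then 0
  else if _hn : (j : ℕ) ≤ n then y ⟨(j : ℕ) - 1, by omega⟩
  else 1

/-- The interval `I_j(y) = [y_j, y_{j+1}]`, `j = 0, …, n`. -/
def nodeInterval {n : ℕ} (y : Fin n → ℝ) (j : Fin (n + 1)) : Set ℝ :=
  Icc (extNode y j.castSucc) (extNode y j.succ)

/-- The sum of translates function `F(y,t) = J(t) + ∑ⱼ rⱼ K(t - yⱼ)`. -/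
def sumTrans {n : ℕ} (r : Fin n → ℝ) (K J : ℝ → EReal) (y : Fin n → ℝ) (t : ℝ) : EReal :=
  J t + ∑ j, (r j : EReal) * K (t - y j)

/-- The interval maximum `m_j(y) = sup_{t ∈ I_j(y)} F(y,t)`. -/
def mj {n : ℕ} (r : Fin n → ℝ) (K J : ℝ → EReal) (j : Fin (n + 1)) (y : Fin n → ℝ) : EReal :=
  sSup (sumTrans r K J y '' nodeInterval y j)

/-- `m̄(y) = max_j m_j(y)`. -/
def mbar {n : ℕ} (r : Fin n → ℝ) (K J : ℝ → EReal) (y : Fin n → ℝ) : EReal :=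
  ⨆ j, mj r K J j y

/-- `m̲(y) = min_j m_j(y)`. -/
def munder {n : ℕ} (r : Fin n → ℝ) (K J : ℝ → EReal) (y : Fin n → ℝ) : EReal :=
  ⨅ j, mj r K J j y

/-- The regularity set `Y`. -/
def regSet {n : ℕ} (r : Fin n → ℝ) (K J : ℝ → EReal) : Set (Fin n → ℝ) :=
  {y ∈ openSimplex n | ∀ j, mj r K J j y ≠ ⊥}

/-- Equioscillation: all interval maxima agree. -/
def Equioscillation {n : ℕ} (r : Fin n → ℝ) (K J : ℝ → EReal) (y : Fin n → ℝ) : Prop :=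
  ∀ i j : Fin (n + 1), mj r K J i y = mj r K J j y

/-- A concave function on an open interval has an antitone selection of supergradients. -/
theorem exists_antitoneOn_supergradient {a b : ℝ} {k : ℝ → ℝ} (hk : ConcaveOn ℝ (Ioo a b) k) :
    ∃ g : ℝ → ℝ, AntitoneOn g (Ioo a b) ∧
      ∀ u ∈ Ioo a b, ∀ v ∈ Ioo a b, k v ≤ k u + g u * (v - u) := by
  have hc : ConvexOn ℝ (Ioo a b) (-k) := hk.neg
  have hi : interior (Ioo a b) = Ioo a b := isOpen_Ioo.interior_eq
  refine ⟨fun u => -derivWithin (-k) (Ioi u) u, fun u hu v hv huv => ?_, fun u hu v hv => ?_⟩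
  · exact neg_le_neg (hc.monotoneOn_rightDeriv (hi.symm ▸ hu) (hi.symm ▸ hv) huv)
  · rcases lt_trichotomy u v with h | rfl | h
    · have h1 := hc.rightDeriv_le_slope_of_mem_interior (hi.symm ▸ hu) hv h
      rw [slope_def_field, le_div_iff₀ (sub_pos.2 h)] at h1
      simp only [Pi.neg_apply] at h1
      linarith
    · simp
    · have h1 := (hc.slope_le_leftDeriv_of_mem_interior hv (hi.symm ▸ hu) h).trans
        (hc.leftDeriv_le_rightDeriv_of_mem_interior (hi.symm ▸ hu))
      rw [slope_def_field, div_le_iff₀ (sub_pos.2 h)] at h1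
      simp only [Pi.neg_apply] at h1
      linarith

/-- A monotone kernel has a selection of supergradients which is antitone on each half, nonpositive
on the negative half and nonnegative on the positive half. -/
theorem IsKernel.exists_supergradient {K : ℝ → EReal} (hK : IsKernel K) (hmono : MonotoneKernel K) :
    ∃ G : ℝ → ℝ, AntitoneOn G (Ioo (-1) 0) ∧ AntitoneOn G (Ioo 0 1) ∧
      (∀ u ∈ Ioo (-1:ℝ) 0, G u ≤ 0) ∧ (∀ u ∈ Ioo (0:ℝ) 1, 0 ≤ G u) ∧
      (∀ u ∈ Ioo (-1:ℝ) 0, ∀ v ∈ Ioo (-1:ℝ) 0,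
        (K v).toReal ≤ (K u).toReal + G u * (v - u)) ∧
      (∀ u ∈ Ioo (0:ℝ) 1, ∀ v ∈ Ioo (0:ℝ) 1,
        (K v).toReal ≤ (K u).toReal + G u * (v - u)) := by
  obtain ⟨g₁, ha₁, hs₁⟩ := exists_antitoneOn_supergradient hK.concave_neg
  obtain ⟨g₂, ha₂, hs₂⟩ := exists_antitoneOn_supergradient hK.concave_pos
  have hG₁ : ∀ u ∈ Ioo (-1:ℝ) 0, (if u < 0 then g₁ u else g₂ u) = g₁ u :=
    fun u hu => if_pos hu.2
  have hG₂ : ∀ u ∈ Ioo (0:ℝ) 1, (if u < 0 then g₁ u else g₂ u) = g₂ u :=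
    fun u hu => if_neg hu.1.not_gt
  refine ⟨fun u => if u < 0 then g₁ u else g₂ u, ha₁.congr fun u hu => (hG₁ u hu).symm,
    ha₂.congr fun u hu => (hG₂ u hu).symm, fun u hu => ?_, fun u hu => ?_,
    fun u hu v hv => by simpa only [hG₁ u hu] using hs₁ u hu v hv,
    fun u hu v hv => by simpa only [hG₂ u hu] using hs₂ u hu v hv⟩
  · obtain ⟨v, hv⟩ := exists_between hu.1
    have hv' : v ∈ Ioo (-1:ℝ) 0 := ⟨hv.1, hv.2.trans hu.2⟩
    have h1 := EReal.toReal_le_toReal (hmono.1 hv' hu hv.2.le)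
      (hK.finite_off_zero u ⟨hu.1, hu.2.trans one_pos⟩ hu.2.ne) (hK.ne_top v)
    have h2 := hs₁ u hu v hv'
    simp only [hG₁ u hu]
    nlinarith [hv.2]
  · obtain ⟨v, hv⟩ := exists_between hu.2
    have hv' : v ∈ Ioo (0:ℝ) 1 := ⟨hu.1.trans hv.1, hv.2⟩
    have h1 := EReal.toReal_le_toReal (hmono.2 hu hv' hv.1.le)
      (hK.finite_off_zero u ⟨by linarith [hu.1], hu.2⟩ hu.1.ne') (hK.ne_top v)
    have h2 := hs₂ u hu v hv'
    simp only [hG₂ u hu]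
    nlinarith [hv.1]

/-- Summation by parts around an index `j` at which the partial sums `W` are minimal: the weights
`e` are nonpositive before `j`, nonnegative from `j` on, and antitone on both sides. -/
theorem sum_mul_sub_nonneg_of_le {e W : ℕ → ℝ} {j n : ℕ} (hjn : j ≤ n)
    (hW : ∀ k ≤ n, W j ≤ W k) (hneg : ∀ i < j, e i ≤ 0) (hpos : ∀ i, j ≤ i → i < n → 0 ≤ e i)
    (hanti : ∀ i, i + 1 < n → i + 1 ≠ j → e (i + 1) ≤ e i) :
    0 ≤ ∑ i ∈ Finset.range n, e i * (W (i + 1) - W i) := by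
  rcases n with _ | n
  · simp
  have key : ∀ k ≤ n, e k * (W (k + 1) - W j) ≤
      ∑ i ∈ Finset.range (k + 1), e i * (W (i + 1) - W i) := by
    intro k
    induction k with
    | zero =>
      intro _
      rcases Nat.eq_zero_or_pos j with rfl | hj
      · simp
      · have := mul_nonneg_of_nonpos_of_nonpos (hneg 0 hj) (sub_nonpos.2 (hW 0 (Nat.zero_le _)))
        simp only [zero_add, Finset.sum_range_one]
        linarith
    | succ k ih =>
      intro hk
      rw [Finset.sum_range_succ]
      have h1 := ih (by omega)
      have h2 : e (k + 1) * (W (k + 1) - W j) ≤ e k * (W (k + 1) - W j) := by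
        by_cases hkj : k + 1 = j
        · simp [hkj]
        · exact mul_le_mul_of_nonneg_right (hanti k (by omega) hkj)
            (sub_nonneg.2 (hW _ (by omega)))
      linarith
  refine le_trans ?_ (key n le_rfl)
  rcases hjn.eq_or_lt with rfl | hj
  · simp
  · exact mul_nonneg (hpos n (by omega) (by omega)) (sub_nonneg.2 (hW _ le_rfl))

theorem mem_nodeInterval_iff {n : ℕ} {x : Fin n → ℝ} (hx : x ∈ openSimplex n) (j : Fin (n + 1))
    (t : ℝ) : t ∈ nodeInterval x j ↔ t ∈ Icc (0:ℝ) 1 ∧ (∀ i : Fin n, (i : ℕ) < j → x i ≤ t) ∧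
      ∀ i : Fin n, (j : ℕ) ≤ i → t ≤ x i := by
  have hj := j.2
  have hleft : extNode x j.castSucc ≤ t ∧ 0 ≤ t ↔
      0 ≤ t ∧ ∀ i : Fin n, (i : ℕ) < j → x i ≤ t := by
    unfold extNode
    simp only [Fin.val_castSucc]
    split_ifs with h0 h1
    · simp [h0]
    · refine ⟨fun h => ⟨h.2, fun i hi => (hx.1.monotone ?_).trans h.1⟩,
        fun h => ⟨h.2 _ (by simp only; omega), h.1⟩⟩
      rw [Fin.le_def]
      simp only
      omega
    · omega
  have hright : t ≤ extNode x j.succ ∧ t ≤ 1 ↔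
      t ≤ 1 ∧ ∀ i : Fin n, (j : ℕ) ≤ i → t ≤ x i := by
    unfold extNode
    simp only [Fin.val_succ, Nat.add_eq_zero_iff, one_ne_zero, and_false, dite_false]
    split_ifs with h1
    · refine ⟨fun h => ⟨h.2, fun i hi => h.1.trans (hx.1.monotone ?_)⟩,
        fun h => ⟨h.2 _ (by simp), h.1⟩⟩
      rw [Fin.le_def]
      simp only
      omega
    · refine ⟨fun h => ⟨h.2, fun i hi => absurd i.2 (by omega)⟩, fun h => ⟨h.1, h.1⟩⟩
  have hl0 : 0 ≤ extNode x j.castSucc := by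
    unfold extNode
    split_ifs
    exacts [le_rfl, (hx.2 _).1.le, zero_le_one]
  have hr1 : extNode x j.succ ≤ 1 := by
    unfold extNode
    split_ifs
    exacts [zero_le_one, (hx.2 _).2.le, le_rfl]
  unfold nodeInterval
  simp only [mem_Icc]
  constructor
  · rintro ⟨h1, h2⟩
    have ha := hleft.1 ⟨h1, hl0.trans h1⟩
    have hb := hright.1 ⟨h2, h2.trans hr1⟩
    exact ⟨⟨ha.1, hb.1⟩, ha.2, hb.2⟩
  · rintro ⟨⟨h0, h1⟩, ha, hb⟩
    exact ⟨(hleft.2 ⟨h0, ha⟩).1, (hright.2 ⟨h1, hb⟩).1⟩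

theorem sumTrans_eq_bot {n : ℕ} {r : Fin n → ℝ} (hr : ∀ j, 0 < r j) {K : ℝ → EReal}
    (hsing : SingularKernel K) (J : ℝ → EReal) (x : Fin n → ℝ) (i : Fin n) :
    sumTrans r K J x (x i) = ⊥ := by
  have hK : K 0 = ⊥ := hsing
  rw [sumTrans, ← Finset.add_sum_erase _ _ (Finset.mem_univ i), sub_self, hK,
    EReal.coe_mul_bot_of_pos (hr i), EReal.bot_add, EReal.add_bot]

theorem sum_mul_kernel_eq_coe {n : ℕ} (r : Fin n → ℝ) {K : ℝ → EReal} (hK : IsKernel K)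
    {x : Fin n → ℝ} {t : ℝ} (ht : ∀ i, t - x i ∈ Ioo (-1:ℝ) 1 ∧ t - x i ≠ 0) :
    ∑ i, (r i : EReal) * K (t - x i) = ((∑ i, r i * (K (t - x i)).toReal : ℝ) : EReal) := by
  have hcoe : ∀ s : Finset (Fin n), ((∑ i ∈ s, r i * (K (t - x i)).toReal : ℝ) : EReal) =
      ∑ i ∈ s, (r i : EReal) * K (t - x i) := by
    intro s
    induction s using Finset.induction_on with
    | empty => simp
    | insert i s hi ih =>
      rw [Finset.sum_insert hi, Finset.sum_insert hi, EReal.coe_add, ih, EReal.coe_mul,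
        EReal.coe_toReal (hK.ne_top _) (hK.finite_off_zero _ (ht i).1 (ht i).2)]
  exact (hcoe _).symm

/-- There is no strict majorization: for any two node systems some interval maximum of the first
does not exceed the corresponding interval maximum of the second. -/
theorem exists_mj_le_mj {n : ℕ} {r : Fin n → ℝ} (hr : ∀ j, 0 < r j) {K : ℝ → EReal}
    (hK : IsKernel K) (hsing : SingularKernel K) (hmono : MonotoneKernel K) (J : ℝ → EReal)
    {x y : Fin n → ℝ} (hx : x ∈ openSimplex n) (hy : y ∈ openSimplex n) :
    ∃ j : Fin (n + 1), mj r K J j x ≤ mj r K J j y := by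
  set d : ℕ → ℝ := fun i => if h : i < n then r ⟨i, h⟩ * (y ⟨i, h⟩ - x ⟨i, h⟩) else 0 with hd
  set W : ℕ → ℝ := fun k => ∑ i ∈ Finset.range k, d i with hWdef
  have hWd : ∀ i, W (i + 1) - W i = d i := fun i => by simp [hWdef, Finset.sum_range_succ]
  have hdi : ∀ i : Fin n, d i = r i * (y i - x i) := fun i => by simp [hd]
  obtain ⟨j, hj⟩ := Finite.exists_min fun k : Fin (n + 1) => W k
  have hjn : (j : ℕ) ≤ n := Nat.lt_succ_iff.1 j.2
  have hmin : ∀ k ≤ n, W j ≤ W k := fun k hk => hj ⟨k, Nat.lt_succ_iff.2 hk⟩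
  refine ⟨j, sSup_le ?_⟩
  rintro _ ⟨t, ht, rfl⟩
  by_cases hnode : ∃ i, t = x i
  · obtain ⟨i, rfl⟩ := hnode
    rw [sumTrans_eq_bot hr hsing]
    exact bot_le
  push Not at hnode
  obtain ⟨ht01, hxl, hxr⟩ := (mem_nodeInterval_iff hx j t).1 ht
  replace hxl : ∀ i : Fin n, (i : ℕ) < j → x i < t := fun i hi => (hxl i hi).lt_of_ne (hnode i).symm
  replace hxr : ∀ i : Fin n, (j : ℕ) ≤ i → t < x i := fun i hi => (hxr i hi).lt_of_ne (hnode i)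
  have hyl : ∀ i : Fin n, (i : ℕ) < j → y i < t := by
    intro i hi
    let p : Fin n := ⟨j - 1, by omega⟩
    have h1 : W ((p : ℕ) + 1) - W p ≤ 0 := by
      have h2 : (p : ℕ) + 1 = j := by simp only [p]; omega
      rw [h2]
      exact sub_nonpos.2 (hmin _ (by omega))
    rw [hWd, hdi] at h1
    have h3 : y p ≤ x p := by nlinarith [hr p]
    have h4 : y i ≤ y p := hy.1.monotone (Fin.le_def.2 (by simp only [p]; omega))
    exact h4.trans_lt (h3.trans_lt (hxl p (by simp only [p]; omega)))
  have hyr : ∀ i : Fin n, (j : ℕ) ≤ i → t < y i := by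
    intro i hi
    let p : Fin n := ⟨j, by omega⟩
    have h1 : 0 ≤ W ((p : ℕ) + 1) - W p := sub_nonneg.2 (hmin _ (by simp only [p]; omega))
    rw [hWd, hdi] at h1
    have h3 : x p ≤ y p := by nlinarith [hr p]
    have h4 : y p ≤ y i := hy.1.monotone (Fin.le_def.2 hi)
    exact ((hxr p le_rfl).trans_le h3).trans_le h4
  have mem_pos : ∀ {z : Fin n → ℝ}, z ∈ openSimplex n → ∀ i, z i < t → t - z i ∈ Ioo (0:ℝ) 1 :=
    fun hz i h => ⟨by linarith, by linarith [(hz.2 i).1, ht01.2]⟩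
  have mem_neg : ∀ {z : Fin n → ℝ}, z ∈ openSimplex n → ∀ i, t < z i → t - z i ∈ Ioo (-1:ℝ) 0 :=
    fun hz i h => ⟨by linarith [(hz.2 i).2, ht01.1], by linarith⟩
  have mem_off : ∀ {z : Fin n → ℝ}, z ∈ openSimplex n → (∀ i : Fin n, (i : ℕ) < j → z i < t) →
      (∀ i : Fin n, (j : ℕ) ≤ i → t < z i) → ∀ i, t - z i ∈ Ioo (-1:ℝ) 1 ∧ t - z i ≠ 0 := by
    intro z hz hl hr' i
    rcases lt_or_ge (i : ℕ) j with h | h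
    · have := mem_pos hz i (hl i h)
      exact ⟨⟨by linarith [this.1], this.2⟩, this.1.ne'⟩
    · have := mem_neg hz i (hr' i h)
      exact ⟨⟨this.1, by linarith [this.2]⟩, this.2.ne⟩
  obtain ⟨G, hanti₁, hanti₂, hneg, hpos, hs₁, hs₂⟩ := hK.exists_supergradient hmono
  have hsub : ∀ i : Fin n, (-G (t - y i)) * d i ≤
      r i * (K (t - y i)).toReal - r i * (K (t - x i)).toReal := by
    intro i
    have h : (K (t - x i)).toReal ≤
        (K (t - y i)).toReal + G (t - y i) * ((t - x i) - (t - y i)) := by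
      rcases lt_or_ge (i : ℕ) j with h | h
      · exact hs₂ _ (mem_pos hy i (hyl i h)) _ (mem_pos hx i (hxl i h))
      · exact hs₁ _ (mem_neg hy i (hyr i h)) _ (mem_neg hx i (hxr i h))
    have := mul_le_mul_of_nonneg_left h (hr i).le
    rw [hdi]
    linarith
  have habel : 0 ≤ ∑ i : Fin n, (-G (t - y i)) * d i := by
    let e : ℕ → ℝ := fun i => if h : i < n then -G (t - y ⟨i, h⟩) else 0
    have he : ∀ i (h : i < n), e i = -G (t - y ⟨i, h⟩) := fun i h => dif_pos h
    have h := sum_mul_sub_nonneg_of_le (e := e) hjn hmin (fun i hi => ?_) (fun i hi hin => ?_)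
      (fun i hin hij => ?_)
    · simp only [hWd] at h
      rw [Finset.sum_range] at h
      simpa only [he _ (Fin.is_lt _)] using h
    · rw [he i (by omega)]
      exact neg_nonpos.2 (hpos _ (mem_pos hy _ (hyl _ hi)))
    · rw [he i hin]
      exact neg_nonneg.2 (hneg _ (mem_neg hy _ (hyr _ hi)))
    · rw [he i (by omega), he (i + 1) hin]
      have hle : y ⟨i, by omega⟩ ≤ y ⟨i + 1, hin⟩ := hy.1.monotone (Fin.le_def.2 (Nat.le_succ i))
      refine neg_le_neg ?_
      rcases lt_or_ge (i + 1) (j : ℕ) with h | h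
      · exact hanti₂ (mem_pos hy _ (hyl _ h)) (mem_pos hy _ (hyl _ (by simp only; omega)))
          (by linarith)
      · exact hanti₁ (mem_neg hy _ (hyr _ h)) (mem_neg hy _ (hyr _ (by simp only; omega)))
          (by linarith)
  have hle : ∑ i, r i * (K (t - x i)).toReal ≤ ∑ i, r i * (K (t - y i)).toReal := by
    have := habel.trans (Finset.sum_le_sum fun i _ => hsub i)
    rw [Finset.sum_sub_distrib] at this
    linarith
  have hty : t ∈ nodeInterval y j := (mem_nodeInterval_iff hy j t).2
    ⟨ht01, fun i hi => (hyl i hi).le, fun i hi => (hyr i hi).le⟩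
  refine le_trans ?_ (le_sSup (mem_image_of_mem _ hty))
  rw [sumTrans, sumTrans, sum_mul_kernel_eq_coe r hK (mem_off hx hxl hxr),
    sum_mul_kernel_eq_coe r hK (mem_off hy hyl hyr)]
  exact add_le_add_right (EReal.coe_le_coe_iff.2 hle) _

theorem statement15 (n : ℕ) (hn : 0 < n) (r : Fin n → ℝ) (hr : ∀ j, 0 < r j)
    (K J : ℝ → EReal) (hK : IsKernel K)
    (hsing : SingularKernel K) (hmono : MonotoneKernel K)
    (hJ : IsFieldFn n J) (hJusc : UpperSemicontinuousOn J (Icc (0:ℝ) 1))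
    (x y : Fin n → ℝ) (hx : x ∈ regSet r K J) (hy : y ∈ regSet r K J)
    (hxm : munder r K J x = ⨆ z ∈ openSimplex n, munder r K J z)
    (heq : (⨆ z ∈ openSimplex n, munder r K J z) = ⨅ z ∈ openSimplex n, mbar r K J z)
    (hym : mbar r K J y = ⨅ z ∈ openSimplex n, mbar r K J z) :
    ∃ j : Fin (n + 1),
      mj r K J j x = (⨆ z ∈ openSimplex n, munder r K J z) ∧
      mj r K J j y = (⨆ z ∈ openSimplex n, munder r K J z) := by
  obtain ⟨j, hj⟩ := exists_mj_le_mj hr hK hsing hmono J hx.1 hy.1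
  have h1 : (⨆ z ∈ openSimplex n, munder r K J z) ≤ mj r K J j x := hxm.symm.le.trans (iInf_le _ j)
  have h2 : mj r K J j y ≤ ⨆ z ∈ openSimplex n, munder r K J z :=
    (le_iSup (fun i => mj r K J i y) j).trans (hym.trans heq.symm).le
  exact ⟨j, (hj.trans h2).antisymm h1, h2.antisymm (h1.trans hj)⟩
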